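/- arXiv:1111.2627 — 4 statements merged into one kernel-verified Lean document; each statement's English description precedes it below -/
import Mathlib

section
/- Let F be a field and let L be a finite-dimensional (left) Leibniz algebra over F with dim L = n. Then there exists a Leibniz L-module V with dim V ≤ n + 1 that is faithful, i.e. the only x ∈ L with λ_x = 0 and ρ_x = 0 is x = 0. -/
/-- Let `L` be a finite-dimensional left Leibniz algebra over a field `F` with
`dim L = n`.  Then there exists a faithful Leibniz `L`-module `V` with
`dim V ≤ n + 1`. -/
theorem faithful_module_of_leibniz (F : Type) [Field F] (L : Type) [AddCommGroup L]
    [Module F L] [FiniteDimensional F L] (n : ℕ) (hn : Module.finrank F L = n)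
    (mul : L →ₗ[F] L →ₗ[F] L)
    (leib : ∀ x y z : L, mul x (mul y z) = mul (mul x y) z + mul y (mul x z)) :
    ∃ (V : Type) (_ : AddCommGroup V) (_ : Module F V)
      (lam rho : L →ₗ[F] V →ₗ[F] V),
      (∀ (x y : L) (v : V), lam x (lam y v) = lam (mul x y) v + lam y (lam x v)) ∧
      (∀ (x y : L) (v : V), lam x (rho y v) = rho y (lam x v) + rho (mul x y) v) ∧
      (∀ (x y : L) (v : V), rho (mul x y) v = rho y (rho x v) + lam x (rho y v)) ∧
      (∀ x : L, lam x = 0 → rho x = 0 → x = 0) ∧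
      FiniteDimensional F V ∧ Module.finrank F V ≤ n + 1 := by
  refine ⟨L × F, inferInstance, inferInstance,
    (mul.compl₂ (LinearMap.fst F L F)).compr₂ (LinearMap.inl F L F),
    ((LinearMap.lsmul F L).flip.compl₂ (LinearMap.snd F L F)).compr₂ (LinearMap.inl F L F),
    ?_, ?_, ?_, ?_, inferInstance, ?_⟩
  · intro x y v
    simpa using leib x y v.1
  · intro x y v
    simp
  · intro x y v
    simp
  · intro x _ h
    simpa using LinearMap.congr_fun h ((0, 1) : L × F)
  · simp [hn]
end

section
/- Let F be a field and let L be a finite-dimensional (left) Leibniz algebra over F with dim L = n. Then there exists a faithful Leibniz L-module V with dim V ≤ n + 1 such that: (1) for every x ∈ L whose left multiplication operator d_x : L → L, d_x(y) = x·y, is nilpotent, the left action λ_x : V → V is nilpotent; and (2) for every x ∈ L whose right multiplication operator r_x : L → L, r_x(y) = y·x, is nilpotent, the right action ρ_x : V → V is nilpotent. -/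
/-- Let `L` be a finite-dimensional left Leibniz algebra over a field `F` with
`dim L = n`.  Then there exists a faithful Leibniz `L`-module `V` with
`dim V ≤ n + 1` such that `λ_x` is nilpotent whenever the left multiplication
`d_x : L → L` is nilpotent, and `ρ_x` is nilpotent whenever the right
multiplication `r_x : L → L` is nilpotent. -/
theorem faithful_module_of_leibniz_with_nilpotency (F : Type) [Field F] (L : Type)
    [AddCommGroup L] [Module F L] [FiniteDimensional F L] (n : ℕ)
    (hn : Module.finrank F L = n)
    (mul : L →ₗ[F] L →ₗ[F] L)
    (leib : ∀ x y z : L, mul x (mul y z) = mul (mul x y) z + mul y (mul x z)) :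
    ∃ (V : Type) (_ : AddCommGroup V) (_ : Module F V)
      (lam rho : L →ₗ[F] V →ₗ[F] V),
      (∀ (x y : L) (v : V), lam x (lam y v) = lam (mul x y) v + lam y (lam x v)) ∧
      (∀ (x y : L) (v : V), lam x (rho y v) = rho y (lam x v) + rho (mul x y) v) ∧
      (∀ (x y : L) (v : V), rho (mul x y) v = rho y (rho x v) + lam x (rho y v)) ∧
      (∀ x : L, lam x = 0 → rho x = 0 → x = 0) ∧
      FiniteDimensional F V ∧ Module.finrank F V ≤ n + 1 ∧
      (∀ x : L, IsNilpotent (mul x : Module.End F L) →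
        IsNilpotent (lam x : Module.End F V)) ∧
      (∀ x : L, IsNilpotent (mul.flip x : Module.End F L) →
        IsNilpotent (rho x : Module.End F V)) := by
  let lam : L →ₗ[F] (L × F) →ₗ[F] (L × F) :=
    LinearMap.mk₂ F (fun x v => (mul x v.1, 0))
      (by simp) (by simp) (by simp) (by simp)
  let rho : L →ₗ[F] (L × F) →ₗ[F] (L × F) :=
    LinearMap.mk₂ F (fun x v => (v.2 • x, 0))
      (by simp) (fun c x v => by simp [smul_comm v.2 c x]) (by simp [add_smul]) (by simp [mul_smul])
  have lam_apply (x : L) (v : L × F) : lam x v = (mul x v.1, 0) := rfl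
  have rho_apply (x : L) (v : L × F) : rho x v = (v.2 • x, 0) := rfl
  refine ⟨L × F, inferInstance, inferInstance, lam, rho, ?_, ?_, ?_, ?_, inferInstance, ?_, ?_, ?_⟩
  · intro x y v
    simp [lam_apply, leib x y v.1]
  · intro x y v
    simp [lam_apply, rho_apply]
  · intro x y v
    simp [lam_apply, rho_apply]
  · intro x _ h
    simpa [rho_apply] using LinearMap.congr_fun h (0, 1)
  · simp [hn]
  · rintro x ⟨k, hk⟩
    have pow_succ_apply (m : ℕ) (v : L × F) :
        ((lam x : Module.End F (L × F)) ^ (m + 1)) v =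
          (((mul x : Module.End F L) ^ (m + 1)) v.1, 0) := by
      induction m with
      | zero => simp [lam_apply]
      | succ m ih =>
        rw [pow_succ', Module.End.mul_apply, ih, lam_apply, pow_succ' _ (m + 1),
          Module.End.mul_apply]
    refine ⟨k + 1, LinearMap.ext fun v => ?_⟩
    rw [pow_succ_apply, pow_succ, hk]
    simp
  · intro x _
    refine ⟨2, LinearMap.ext fun v => ?_⟩
    simp [pow_two, rho_apply]
end

section
/- Let M be a (left) Leibniz algebra over a field F, let B ⊆ M be a subspace with M·B ⊆ B and B·M = 0, and let U ⊆ M be a subalgebra (U·U ⊆ U) such that M = U ⊕ B as vector spaces; let π_B : M → B denote the linear projection onto B along U. Then the vector space V = F × B, equipped with the left action λ_m(t, b) = (0, m·b) and the right action ρ_m(t, b) = (0, t • π_B(m)) for m ∈ M, t ∈ F, b ∈ B, is a Leibniz M-module. -/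
/-- The projection onto `B` along the subalgebra `U` commutes with left multiplications. -/
theorem proj_mul_eq_mul_proj {F M : Type*} [Field F] [AddCommGroup M] [Module F M]
    (mul : M →ₗ[F] M →ₗ[F] M) {B U : Submodule F M}
    (hMB : ∀ m : M, ∀ b ∈ B, mul m b ∈ B)
    (hBM : ∀ b ∈ B, ∀ m : M, mul b m = 0)
    (hU : ∀ u ∈ U, ∀ u' ∈ U, mul u u' ∈ U)
    (hcompl : IsCompl U B) (π : M →ₗ[F] M)
    (hπb : ∀ b ∈ B, π b = b) (hπu : ∀ u ∈ U, π u = 0) (x y : M) :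
    π (mul x y) = mul x (π y) := by
  have decomp (m : M) : ∃ u ∈ U, ∃ b ∈ B, u + b = m :=
    Submodule.mem_sup.mp (hcompl.sup_eq_top ▸ Submodule.mem_top)
  obtain ⟨u, hu, b, hb, rfl⟩ := decomp x
  obtain ⟨u', hu', b', hb', rfl⟩ := decomp y
  simp [hBM b hb, hπu u' hu', hπb b' hb', hπu _ (hU u hu u' hu'), hπb _ (hMB u b' hb')]


/-- Let `M` be a left Leibniz algebra, `B` a subspace with `M·B ⊆ B` and
`B·M = 0`, and `U` a subalgebra with `M = U ⊕ B`; let `π` be the projection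
onto `B` along `U`.  Then `V = F × B` with `λ_m (t, b) = (0, m·b)` and
`ρ_m (t, b) = (0, t • π(m))` is a Leibniz `M`-module. -/
theorem split_construction_is_leibniz_module (F : Type*) [Field F] (M : Type*)
    [AddCommGroup M] [Module F M]
    (mul : M →ₗ[F] M →ₗ[F] M)
    (leib : ∀ x y z : M, mul x (mul y z) = mul (mul x y) z + mul y (mul x z))
    (B U : Submodule F M)
    (hMB : ∀ m : M, ∀ b ∈ B, mul m b ∈ B)
    (hBM : ∀ b ∈ B, ∀ m : M, mul b m = 0)
    (hU : ∀ u ∈ U, ∀ u' ∈ U, mul u u' ∈ U)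
    (hcompl : IsCompl U B)
    (π : M →ₗ[F] M)
    (hπB : ∀ m : M, π m ∈ B)
    (hπb : ∀ b ∈ B, π b = b)
    (hπu : ∀ u ∈ U, π u = 0) :
    let lam : M → F × B → F × B :=
      fun m v => ((0 : F), ⟨mul m v.2, hMB m v.2 v.2.2⟩)
    let rho : M → F × B → F × B :=
      fun m v => ((0 : F), ⟨v.1 • π m, B.smul_mem v.1 (hπB m)⟩)
    (∀ (x y : M) (v : F × B), lam x (lam y v) = lam (mul x y) v + lam y (lam x v)) ∧
    (∀ (x y : M) (v : F × B), lam x (rho y v) = rho y (lam x v) + rho (mul x y) v) ∧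
    (∀ (x y : M) (v : F × B), rho (mul x y) v = rho y (rho x v) + lam x (rho y v)) := by
  have hπ := proj_mul_eq_mul_proj mul hMB hBM hU hcompl π hπb hπu
  refine ⟨fun x y v => ?_, fun x y v => ?_, fun x y v => ?_⟩
  · ext
    · simp
    · simpa using leib x y v.2
  · ext <;> simp [hπ]
  · ext <;> simp [hπ]
end

section
/- Let M be a (left) Leibniz algebra over a field F, let B ⊆ M be a subspace with M·B ⊆ B and B·M = 0, let U ⊆ M be a subalgebra with M = U ⊕ B as vector spaces, and let V = F × B be the Leibniz M-module with λ_m(t, b) = (0, m·b) and ρ_m(t, b) = (0, t • π_B(m)), where π_B is the projection onto B along U. If the left action of U on B is faithful, i.e. the only u ∈ U with u·b = 0 for all b ∈ B is u = 0, then V is a faithful M-module: the only m ∈ M with λ_m = 0 and ρ_m = 0 is m = 0. -/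
/-- With `M`, `B`, `U`, `π` and `V = F × B` as in the Construction 2 module:
if the left action of `U` on `B` is faithful, then `V` is a faithful
`M`-module. -/
theorem split_construction_faithful (F : Type*) [Field F] (M : Type*)
    [AddCommGroup M] [Module F M]
    (mul : M →ₗ[F] M →ₗ[F] M)
    (leib : ∀ x y z : M, mul x (mul y z) = mul (mul x y) z + mul y (mul x z))
    (B U : Submodule F M)
    (hMB : ∀ m : M, ∀ b ∈ B, mul m b ∈ B)
    (hBM : ∀ b ∈ B, ∀ m : M, mul b m = 0)
    (hU : ∀ u ∈ U, ∀ u' ∈ U, mul u u' ∈ U)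
    (hcompl : IsCompl U B)
    (π : M →ₗ[F] M)
    (hπB : ∀ m : M, π m ∈ B)
    (hπb : ∀ b ∈ B, π b = b)
    (hπu : ∀ u ∈ U, π u = 0)
    (hfaith : ∀ u ∈ U, (∀ b ∈ B, mul u b = 0) → u = 0) :
    let lam : M → F × B → F × B :=
      fun m v => ((0 : F), ⟨mul m v.2, hMB m v.2 v.2.2⟩)
    let rho : M → F × B → F × B :=
      fun m v => ((0 : F), ⟨v.1 • π m, B.smul_mem v.1 (hπB m)⟩)
    ∀ m : M, (∀ v : F × B, lam m v = 0) → (∀ v : F × B, rho m v = 0) → m = 0 := by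
  intro lam rho m hlam hrho
  have hπm : π m = 0 := by
    simpa [rho] using congrArg (fun w : F × B => (w.2 : M)) (hrho (1, 0))
  obtain ⟨u, hu, b, hb, rfl⟩ :=
    Submodule.mem_sup.mp (hcompl.sup_eq_top ▸ Submodule.mem_top : m ∈ U ⊔ B)
  have hb0 : b = 0 := by simpa [hπu u hu, hπb b hb] using hπm
  subst hb0
  rw [add_zero] at hlam ⊢
  exact hfaith u hu fun b hb => congrArg (fun w : F × B => (w.2 : M)) (hlam (0, ⟨b, hb⟩))
end
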